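/- Let X be an infinite set, Y ⊆ X, let G be an injection from the power set of X into seq(X), and let H be an injection from seq(Y) into Y. Define D = {x ∈ Y | H⁻¹(x) is defined and lies in the range of G, and x ∉ G⁻¹(H⁻¹(x))}. Then the sequence G(D) is not a member of seq(Y); that is, some entry of the finite sequence G(D) lies in X \ Y. -/

import Mathlib

/-- The diagonal step of the Halbeisen–Shelah argument.  Let `X` be an infinite set,
`Y ⊆ X`, let `G` be an injection from the power set of `X` into `seq(X)` (the finite
sequences on `X`, represented as lists), and let `H` be an injection from
`seq(Y) = {l | ∀ a ∈ l, a ∈ Y}` into `Y`.  Let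
`D = {x ∈ Y | H⁻¹(x) exists, lies in the range of G, and x ∉ G⁻¹(H⁻¹(x))}`.
Then `G D ∉ seq(Y)`; that is, some entry of the list `G D` lies in `X \ Y`. -/
theorem diagonal_not_mem_seq (X : Type*) (hX : Infinite X) (Y : Set X)
    (G : Set X → List X) (hG : Function.Injective G)
    (H : List X → X)
    (hHinj : Set.InjOn H {l : List X | ∀ a ∈ l, a ∈ Y})
    (hHmaps : Set.MapsTo H {l : List X | ∀ a ∈ l, a ∈ Y} Y)
    (D : Set X)
    (hD : D = {x | x ∈ Y ∧ ∃ l : List X, (∀ a ∈ l, a ∈ Y) ∧ H l = x ∧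
      ∃ S : Set X, G S = l ∧ x ∉ S}) :
    ∃ a ∈ G D, a ∉ Y := by
  by_contra hcon
  have hY : ∀ a ∈ G D, a ∈ Y := fun a ha => by
    by_contra h
    exact hcon ⟨a, ha, h⟩
  have key : H (G D) ∈ D ↔ (H (G D) ∈ Y ∧ ∃ l : List X, (∀ a ∈ l, a ∈ Y) ∧ H l = H (G D) ∧
      ∃ S : Set X, G S = l ∧ H (G D) ∉ S) := Set.ext_iff.mp hD (H (G D))
  have hnot : H (G D) ∉ D := by
    intro hmem
    obtain ⟨_, l, hl, hHl, S, hS, hx⟩ := key.mp hmem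
    have h1 : l = G D := hHinj hl hY hHl
    have h2 : S = D := hG (hS.trans h1)
    exact hx (h2 ▸ hmem)
  exact hnot (key.mpr ⟨hHmaps hY, G D, hY, rfl, D, rfl, hnot⟩)
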